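/- arXiv:2403.18060 — 3 statements merged into one kernel-verified Lean document; each statement's English description precedes it below -/
import Mathlib

section
/- In the Impish-start cordiality game on the path P_6, and also in the Impish-start-with-pass variant, Admirable has a strategy guaranteeing final discrepancy at most 1, and every complete play ends with discrepancy at least 1; hence c'_g(P_6) = c*_g(P_6) = 1. -/
open Finset

variable {V : Type} [Fintype V] [DecidableEq V]

/-- The number of edges of `G` with exactly one endpoint in `S`
(each such edge is counted once, as the ordered pair whose first
coordinate lies in `S`). This is the cut function `φ`. -/
def cutSize (G : SimpleGraph V) [DecidableRel G.Adj] (S : Finset V) : ℕ :=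
  ((univ ×ˢ univ).filter (fun p : V × V => G.Adj p.1 p.2 ∧ p.1 ∈ S ∧ p.2 ∉ S)).card

/-- The number of edges of `G`. -/
def edgeCount (G : SimpleGraph V) [DecidableRel G.Adj] : ℕ := G.edgeFinset.card

/-- The (unsigned) discrepancy `|e₁ - e₀|` of the labeling in which exactly the
vertices of `S` are labeled `0`: `e₁ = φ(S)` and `e₀ = |E| - φ(S)`. -/
def cordDisc (G : SimpleGraph V) [DecidableRel G.Adj] (S : Finset V) : ℤ :=
  |2 * (cutSize G S : ℤ) - (edgeCount G : ℤ)|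

/-- The signed discrepancy `e₁ - e₀` of the labeling in which exactly the
vertices of `S` are labeled `0`. -/
def balDisc (G : SimpleGraph V) [DecidableRel G.Adj] (S : Finset V) : ℤ :=
  2 * (cutSize G S : ℤ) - (edgeCount G : ℤ)

/-- The min-max value of the vertex-selection game: Admirable (the minimizer)
and Impish (the maximizer) alternately select unselected vertices from `rem`
until none remain; `A` is the set of vertices selected by Admirable so far,
`turn = true` means it is Admirable's turn, and `p` is the number of times
Impish may still pass his turn.  The final payoff is `payoff A` where `A` is
the set of all vertices Admirable selected.  `gameVal payoff p rem A turn ≤ k`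
holds iff Admirable has a strategy guaranteeing payoff at most `k`, and
`gameVal payoff p rem A turn ≥ k` holds iff Impish has a strategy
guaranteeing payoff at least `k`. -/
def gameVal (payoff : Finset V → ℤ) (p : ℕ) (rem A : Finset V) (turn : Bool) : ℤ :=
  if hrem : rem.Nonempty then
    if turn then
      rem.attach.inf' (Finset.attach_nonempty_iff.mpr hrem)
        (fun v => gameVal payoff p (rem.erase v.1) (insert v.1 A) false)
    else
      let m := rem.attach.sup' (Finset.attach_nonempty_iff.mpr hrem)
        (fun v => gameVal payoff p (rem.erase v.1) A true)
      if hp : p = 0 then m else max m (gameVal payoff (p - 1) rem A true)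
  else payoff A
termination_by rem.card + p
decreasing_by
  · exact Nat.add_lt_add_right (Finset.card_erase_lt_of_mem v.2) p
  · exact Nat.add_lt_add_right (Finset.card_erase_lt_of_mem v.2) p
  · omega

/-- The game cordiality number `c_g(G)`: Admirable moves first. -/
def cg (G : SimpleGraph V) [DecidableRel G.Adj] : ℤ :=
  gameVal (cordDisc G) 0 univ ∅ true

/-- The Impish-start game cordiality number `c'_g(G)`. -/
def cg' (G : SimpleGraph V) [DecidableRel G.Adj] : ℤ :=
  gameVal (cordDisc G) 0 univ ∅ false

/-- The Impish-start-with-pass game cordiality number `c*_g(G)`: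
Impish moves first and may pass at most once. -/
def cgStar (G : SimpleGraph V) [DecidableRel G.Adj] : ℤ :=
  gameVal (cordDisc G) 1 univ ∅ false

/-- The game balance number `b_g(G)`: Admirable moves first, payoff is the
signed discrepancy `e₁ - e₀`. -/
def bg (G : SimpleGraph V) [DecidableRel G.Adj] : ℤ :=
  gameVal (balDisc G) 0 univ ∅ true

/-- The path `P_n` on vertices `v_1, …, v_n`, encoded as `0, …, n-1 : Fin n`. -/
def pathG (n : ℕ) : SimpleGraph (Fin n) :=
  SimpleGraph.fromRel (fun i j => (i : ℕ) + 1 = (j : ℕ))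

instance pathGDecidable (n : ℕ) : DecidableRel (pathG n).Adj :=
  fun a b => decidable_of_iff _ (SimpleGraph.fromRel_adj _ a b).symm

/-- Within `n` moves (passes included), Admirable can finish the vertex-selection game from the
given position with a final set satisfying `good`. -/
def AdmirableCanForce {α : Type} [DecidableEq α] (good : Finset α → Prop) :
    ℕ → ℕ → Finset α → Finset α → Bool → Prop
  | 0, _, _, _, _ => False
  | n + 1, p, rem, A, true =>
      (rem = ∅ ∧ good A) ∨
        ∃ v ∈ rem, AdmirableCanForce good n p (rem.erase v) (insert v A) false
  | n + 1, p, rem, A, false =>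
      (rem = ∅ ∧ good A) ∨ (rem ≠ ∅ ∧
        (∀ v ∈ rem, AdmirableCanForce good n p (rem.erase v) A true) ∧
        (p = 0 ∨ AdmirableCanForce good n (p - 1) rem A true))

instance AdmirableCanForce.decidable {α : Type} [DecidableEq α]
    (good : Finset α → Prop) [DecidablePred good] :
    ∀ n p rem A turn, Decidable (AdmirableCanForce good n p rem A turn)
  | 0, _, _, _, _ => inferInstanceAs (Decidable False)
  | n + 1, p, rem, A, true =>
      have := AdmirableCanForce.decidable good n
      inferInstanceAs (Decidable ((rem = ∅ ∧ good A) ∨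
        ∃ v ∈ rem, AdmirableCanForce good n p (rem.erase v) (insert v A) false))
  | n + 1, p, rem, A, false =>
      have := AdmirableCanForce.decidable good n
      inferInstanceAs (Decidable ((rem = ∅ ∧ good A) ∨ (rem ≠ ∅ ∧
        (∀ v ∈ rem, AdmirableCanForce good n p (rem.erase v) A true) ∧
        (p = 0 ∨ AdmirableCanForce good n (p - 1) rem A true))))

theorem gameVal_le_of_admirableCanForce {α : Type} [DecidableEq α]
    {payoff : Finset α → ℤ} {good : Finset α → Prop} {k : ℤ} (hgood : ∀ A, good A → payoff A ≤ k)
    {n p : ℕ} {rem A : Finset α} {turn : Bool}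
    (h : AdmirableCanForce good n p rem A turn) : gameVal payoff p rem A turn ≤ k := by
  induction n generalizing p rem A turn with
  | zero => exact h.elim
  | succ n ih =>
    cases turn with
    | true =>
      rcases h with ⟨rfl, hA⟩ | ⟨v, hv, h⟩
      · rw [gameVal, dif_neg (by simp)]
        exact hgood A hA
      · rw [gameVal, dif_pos ⟨v, hv⟩, if_pos rfl]
        exact (Finset.inf'_le _ (Finset.mem_attach _ ⟨v, hv⟩)).trans (ih h)
    | false =>
      rcases h with ⟨rfl, hA⟩ | ⟨hrem, hmove, hpass⟩
      · rw [gameVal, dif_neg (by simp)]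
        exact hgood A hA
      · rw [gameVal, dif_pos (nonempty_iff_ne_empty.mpr hrem), if_neg (by simp)]
        have hsup := Finset.sup'_le (Finset.attach_nonempty_iff.mpr
          (nonempty_iff_ne_empty.mpr hrem))
          (fun v : rem => gameVal payoff p (rem.erase v.1) A true)
          (fun v _ => ih (hmove v.1 v.2))
        split_ifs with hp
        · exact hsup
        · exact max_le hsup (ih (hpass.resolve_left hp))

theorem le_gameVal {α : Type} [DecidableEq α] {payoff : Finset α → ℤ} {k : ℤ}
    (hpayoff : ∀ A, k ≤ payoff A)
    (p : ℕ) (rem A : Finset α) (turn : Bool) : k ≤ gameVal payoff p rem A turn := by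
  fun_induction gameVal payoff p rem A turn with
  | case1 p rem A hrem ih => exact Finset.le_inf' _ _ fun v _ => ih v
  | case2 rem A turn hrem hturn m ih =>
    obtain ⟨v, hv⟩ := hrem
    exact (ih ⟨v, hv⟩).trans (Finset.le_sup'
      (fun v : rem => gameVal payoff 0 (rem.erase v.1) A true)
      (Finset.mem_attach _ ⟨v, hv⟩))
  | case3 p rem A turn hrem hturn m hp ih ih' => exact le_max_of_le_right ih'
  | case4 p rem A turn hrem => exact hpayoff A

theorem edgeCount_path6 : edgeCount (pathG 6) = 5 := by decide +kernel

/-- The discrepancy is odd, since `P₆` has five edges. -/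
theorem one_le_cordDisc_path6 (S : Finset (Fin 6)) : 1 ≤ cordDisc (pathG 6) S := by
  rw [cordDisc, edgeCount_path6]
  exact Int.one_le_abs (by omega)

theorem cordDisc_path6_le_one {S : Finset (Fin 6)}
    (h : cutSize (pathG 6) S = 2 ∨ cutSize (pathG 6) S = 3) : cordDisc (pathG 6) S ≤ 1 := by
  rw [cordDisc, edgeCount_path6, abs_le]
  omega

theorem admirableCanForce_path6 : ∀ p ∈ ({0, 1} : Finset ℕ),
    AdmirableCanForce
      (fun S => cutSize (pathG 6) S = 2 ∨ cutSize (pathG 6) S = 3) (7 + p) p univ ∅ false := by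
  decide +kernel

/-- the Impish-start and Impish-start-with-pass game cordiality
numbers of `P₆` are `1`. -/
theorem cg'_cgStar_path6 : cg' (pathG 6) = 1 ∧ cgStar (pathG 6) = 1 := by
  have hval (p : ℕ) (hp : p ∈ ({0, 1} : Finset ℕ)) :
      gameVal (cordDisc (pathG 6)) p univ ∅ false = 1 :=
    le_antisymm
      (gameVal_le_of_admirableCanForce (fun _ => cordDisc_path6_le_one)
        (admirableCanForce_path6 p hp))
      (le_gameVal one_le_cordDisc_path6 p univ ∅ false)
  exact ⟨hval 0 (by simp), hval 1 (by simp)⟩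
end

section
/- For every integer n ≥ 3, in the cordiality game on the path P_n with Admirable moving first, Admirable has a strategy guaranteeing final discrepancy at most 2⌊n/6⌋ − 1 if n ≡ 0 (mod 6), at most 2⌊n/6⌋ if n ≡ 1 or 3 (mod 6), at most 2⌊n/6⌋ + 1 if n ≡ 2 or 4 (mod 6), and at most 2⌊n/6⌋ + 2 if n ≡ 5 (mod 6); in particular c_g(P_n) is at most the corresponding value. -/
open Finset

variable {V : Type} [Fintype V] [DecidableEq V]

/-- The tolerated discrepancy on a block of `m` consecutive vertices of a path. -/
def blockTol : ℕ → ℤ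
  | 2 => 1
  | 4 => 1
  | 5 => 2
  | 6 => 1
  | _ => 0

/-- The signed contribution to `e₁ - e₀` of the edge joining `x` and `x + 1`. -/
def edgeSign (s : ℕ → Option Bool) (x : ℕ) : ℤ := if s x = s (x + 1) then -1 else 1

/-- All `m` vertices of the block are selected and its discrepancy is tolerable. -/
def BlockDone (m : ℕ) (s : ℕ → Option Bool) : Prop :=
  (∀ i < m, s i ≠ none) ∧ |∑ i ∈ range (m - 1), edgeSign s i| ≤ blockTol m

instance (m : ℕ) (s : ℕ → Option Bool) : Decidable (BlockDone m s) :=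
  inferInstanceAs (Decidable (_ ∧ _))

/-- With Impish to move in a block of `m` vertices whose selections are recorded by `s`
(`some true` for Admirable, `some false` for Impish), Admirable can finish within at most `t`
rounds with a tolerable discrepancy. Impish may pass once if `b` is true, and in that case
Admirable must always be able to answer inside the block. -/
def BlockGood (m : ℕ) : ℕ → Bool → (ℕ → Option Bool) → Prop
  | 0, _, s => BlockDone m s
  | t + 1, b, s =>
    BlockDone m s ∨
    ((∃ i < m, s i = none) ∧
    (∀ i < m, s i = none →
      (b = false ∧ BlockDone m (Function.update s i (some false))) ∨
      ∃ w < m, Function.update s i (some false) w = none ∧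
        BlockGood m t b (Function.update (Function.update s i (some false)) w (some true))) ∧
    (b = true → ∃ w < m, s w = none ∧ BlockGood m t false (Function.update s w (some true))))

instance decidableBlockGood (m : ℕ) :
    ∀ t b s, Decidable (BlockGood m t b s)
  | 0, _, _ => inferInstanceAs (Decidable (BlockDone m _))
  | t + 1, _, _ =>
    have := decidableBlockGood m t
    inferInstanceAs (Decidable (_ ∨ _ ∧ _ ∧ _))

theorem blockGood_six : BlockGood 6 4 true (fun _ => none) := by decide +kernel

theorem exists_blockGood_first_move {r : ℕ} (h₀ : 0 < r) (h₆ : r ≤ 6) :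
    ∃ w < r, BlockGood r 3 false (Function.update (fun _ => none) w (some true)) := by
  interval_cases r <;> decide +kernel

theorem BlockGood.done_of_full {m t : ℕ} {b : Bool} {s : ℕ → Option Bool}
    (h : BlockGood m t b s) (hs : ∀ i < m, s i ≠ none) : BlockDone m s := by
  cases t with
  | zero => exact h
  | succ t =>
    rcases h with h | ⟨⟨i, hi, hn⟩, -⟩
    · exact h
    · exact absurd hn (hs i hi)

theorem BlockGood.reply {m t i : ℕ} {b : Bool} {s : ℕ → Option Bool}
    (h : BlockGood m t b s) (hi : i < m) (hs : s i = none) :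
    (b = false ∧ BlockDone m (Function.update s i (some false))) ∨
      ∃ w < m, Function.update s i (some false) w = none ∧ ∃ t',
        BlockGood m t' b (Function.update (Function.update s i (some false)) w (some true)) := by
  cases t with
  | zero => exact absurd hs (h.1 i hi)
  | succ t =>
    rcases h with h | ⟨-, h, -⟩
    · exact absurd hs (h.1 i hi)
    · rcases h i hi hs with h | ⟨w, hw, hn, h⟩
      · exact Or.inl h
      · exact Or.inr ⟨w, hw, hn, t, h⟩

theorem BlockGood.pass {m t i : ℕ} {s : ℕ → Option Bool}
    (h : BlockGood m t true s) (hi : i < m) (hs : s i = none) :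
    ∃ w < m, s w = none ∧ ∃ t', BlockGood m t' false (Function.update s w (some true)) := by
  cases t with
  | zero => exact absurd hs (h.1 i hi)
  | succ t =>
    rcases h with h | ⟨-, -, h⟩
    · exact absurd hs (h.1 i hi)
    · obtain ⟨w, hw, hn, h⟩ := h rfl
      exact ⟨w, hw, hn, t, h⟩

/-- An invariant that Admirable can restore after each Impish move bounds the game value. -/
theorem gameVal_le_of_invariant {α : Type} [DecidableEq α] (f : Finset α → ℤ) (c : ℤ)
    (Inv : Finset α → Finset α → Prop)
    (h_end : ∀ A, Inv ∅ A → f A ≤ c)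
    (h_step : ∀ R A v, Inv R A → v ∈ R → (R.erase v = ∅ ∧ f A ≤ c) ∨
      ∃ w ∈ R.erase v, Inv ((R.erase v).erase w) (insert w A))
    (R A : Finset α) (h : Inv R A) : gameVal f 0 R A false ≤ c := by
  induction R using Finset.strongInduction generalizing A with
  | H R ih =>
    rw [gameVal]
    split_ifs with hR hp
    · contradiction
    · refine Finset.sup'_le _ _ fun v _ => ?_
      rw [gameVal]
      rcases h_step R A v h v.2 with ⟨he, hf⟩ | ⟨w, hw, hi⟩
      · simpa [he] using hf
      · rw [dif_pos ⟨w, hw⟩, if_pos rfl]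
        refine (Finset.inf'_le _ (mem_attach _ ⟨w, hw⟩)).trans (ih _ ?_ _ hi)
        exact (erase_ssubset hw).trans (erase_ssubset v.2)
    · contradiction
    · rw [not_nonempty_iff_eq_empty] at hR
      subst hR
      exact h_end A h

/-- Admirable, who moves first, can enforce any such invariant that he can establish. -/
theorem cg_le_of_invariant (G : SimpleGraph V) [DecidableRel G.Adj] (c : ℤ)
    (Inv : Finset V → Finset V → Prop) (h_end : ∀ A, Inv ∅ A → cordDisc G A ≤ c)
    (h_step : ∀ R A v, Inv R A → v ∈ R → (R.erase v = ∅ ∧ cordDisc G A ≤ c) ∨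
      ∃ w ∈ R.erase v, Inv ((R.erase v).erase w) (insert w A))
    (w : V) (hw : Inv (univ.erase w) {w}) : cg G ≤ c := by
  rw [cg, gameVal, dif_pos ⟨w, mem_univ w⟩, if_pos rfl]
  exact (Finset.inf'_le _ (mem_attach _ ⟨w, mem_univ w⟩)).trans
    (gameVal_le_of_invariant _ c Inv h_end h_step _ _ hw)

/-- The selection recorded by a position: `R` is unselected and `A` was selected by Admirable. -/
def posLabel {n : ℕ} (R A : Finset (Fin n)) (x : ℕ) : Option Bool :=
  if x ∈ R.map Fin.valEmbedding then none else some (decide (x ∈ A.map Fin.valEmbedding))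

theorem posLabel_eq_none {n : ℕ} {R A : Finset (Fin n)} {x : ℕ} :
    posLabel R A x = none ↔ ∃ h : x < n, ⟨x, h⟩ ∈ R := by
  have : (∃ v ∈ R, (v : ℕ) = x) ↔ ∃ h : x < n, ⟨x, h⟩ ∈ R :=
    ⟨fun ⟨v, hv, e⟩ => e ▸ ⟨v.2, hv⟩, fun ⟨h, hx⟩ => ⟨_, hx, rfl⟩⟩
  simp [posLabel, this]

theorem posLabel_erase {n : ℕ} {R A : Finset (Fin n)} {v : Fin n} (hv : v ∉ A) :
    posLabel (R.erase v) A = Function.update (posLabel R A) v (some false) := by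
  funext x
  rcases eq_or_ne x v with rfl | h
  · simp [posLabel, Fin.val_inj, hv]
  · have : ∀ a : Fin n, (a : ℕ) = x → a ≠ v := by rintro a rfl rfl; exact h rfl
    have : (∃ a ∈ R.erase v, (a : ℕ) = x) ↔ ∃ a ∈ R, (a : ℕ) = x := by
      constructor
      · rintro ⟨a, ha, e⟩; exact ⟨a, mem_of_mem_erase ha, e⟩
      · rintro ⟨a, ha, e⟩; exact ⟨a, mem_erase.2 ⟨this a e, ha⟩, e⟩
    simp only [posLabel, Function.update_of_ne h, mem_map, Fin.valEmbedding_apply, this]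

theorem posLabel_erase_insert {n : ℕ} {R A : Finset (Fin n)} {v : Fin n} :
    posLabel (R.erase v) (insert v A) = Function.update (posLabel R A) v (some true) := by
  funext x
  rcases eq_or_ne x v with rfl | h
  · simp [posLabel]
  · have : ∀ a : Fin n, (a : ℕ) = x → a ≠ v := by rintro a rfl rfl; exact h rfl
    have h₁ : (∃ a ∈ R.erase v, (a : ℕ) = x) ↔ ∃ a ∈ R, (a : ℕ) = x := by
      constructor
      · rintro ⟨a, ha, e⟩; exact ⟨a, mem_of_mem_erase ha, e⟩
      · rintro ⟨a, ha, e⟩; exact ⟨a, mem_erase.2 ⟨this a e, ha⟩, e⟩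
    have h₂ : (∃ a ∈ insert v A, (a : ℕ) = x) ↔ ∃ a ∈ A, (a : ℕ) = x := by
      constructor
      · rintro ⟨a, ha, e⟩; exact ⟨a, mem_of_mem_insert_of_ne ha (this a e), e⟩
      · rintro ⟨a, ha, e⟩; exact ⟨a, mem_insert_of_mem ha, e⟩
    simp only [posLabel, Function.update_of_ne h, mem_map, Fin.valEmbedding_apply, h₁, h₂]

theorem pathG_adj {n : ℕ} {a b : Fin n} :
    (pathG n).Adj a b ↔ (a : ℕ) + 1 = b ∨ (b : ℕ) + 1 = a := by
  rw [pathG, SimpleGraph.fromRel_adj]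
  refine ⟨fun h => h.2, fun h => ⟨?_, h⟩⟩
  rintro rfl
  omega

theorem edgeCount_pathG (n : ℕ) : edgeCount (pathG n) = n - 1 := by
  rw [← card_range (n - 1), edgeCount]
  symm
  refine card_bij (fun x hx => s(⟨x, by have := mem_range.1 hx; omega⟩,
    ⟨x + 1, by have := mem_range.1 hx; omega⟩)) ?_ ?_ ?_
  · intro x hx
    simp [pathG_adj]
  · intro x _ y _ h
    simp only [Sym2.eq_iff, Fin.mk.injEq] at h
    omega
  · intro e
    induction e with
    | _ a b =>
      intro h
      rw [SimpleGraph.mem_edgeFinset, SimpleGraph.mem_edgeSet, pathG_adj] at h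
      have := a.2
      have := b.2
      rcases h with h | h
      · exact ⟨a, by simp; omega, by simp [h]⟩
      · exact ⟨b, by simp; omega, by simp [h, Sym2.eq_swap]⟩

theorem cutSize_pathG {n : ℕ} (A : Finset (Fin n)) :
    cutSize (pathG n) A =
      #{x ∈ range (n - 1) | posLabel ∅ A x ≠ posLabel ∅ A (x + 1)} := by
  have key : ∀ {x : ℕ} (hx : x < n), posLabel ∅ A x = some (decide (⟨x, hx⟩ ∈ A)) := by
    intro x hx
    have : (∃ v ∈ A, (v : ℕ) = x) ↔ ⟨x, hx⟩ ∈ A :=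
      ⟨fun ⟨v, hv, e⟩ => by subst e; exact hv, fun h => ⟨_, h, rfl⟩⟩
    simp [posLabel, this]
  refine card_bij (fun p _ => min (p.1 : ℕ) p.2) ?_ ?_ ?_
  · rintro ⟨⟨a, ha⟩, ⟨b, hb⟩⟩ h
    simp only [mem_filter, pathG_adj] at h
    obtain ⟨-, h | h, h₁, h₂⟩ := h
    · subst h
      simp only [mem_filter, mem_range, le_add_iff_nonneg_right, zero_le, inf_of_le_left]
      refine ⟨by omega, ?_⟩
      rw [key ha, key hb]
      simp [h₁, h₂]
    · subst h
      simp only [mem_filter, mem_range, le_add_iff_nonneg_right, zero_le, inf_of_le_right]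
      refine ⟨by omega, ?_⟩
      rw [key ha, key hb]
      simp [h₁, h₂]
  · rintro ⟨⟨a, ha⟩, ⟨b, hb⟩⟩ h ⟨⟨c, hc⟩, ⟨d, hd⟩⟩ h' e
    simp only [mem_filter, pathG_adj] at h h' e
    obtain ⟨-, h, h₁, h₂⟩ := h
    obtain ⟨-, h', h₁', h₂'⟩ := h'
    have : a = c ∧ b = d ∨ a = d ∧ b = c := by omega
    rcases this with ⟨rfl, rfl⟩ | ⟨rfl, rfl⟩
    · rfl
    · contradiction
  · intro x hx
    rw [mem_filter, mem_range] at hx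
    obtain ⟨hx, hne⟩ := hx
    have hx₀ : x < n := by omega
    have hx₁ : x + 1 < n := by omega
    rw [key hx₀, key hx₁] at hne
    by_cases h₀ : (⟨x, hx₀⟩ : Fin n) ∈ A
    · refine ⟨(⟨x, hx₀⟩, ⟨x + 1, hx₁⟩), ?_, by simp⟩
      simpa [pathG_adj, h₀] using hne
    · refine ⟨(⟨x + 1, hx₁⟩, ⟨x, hx₀⟩), ?_, by simp⟩
      simpa [pathG_adj, h₀] using hne

theorem cordDisc_pathG {n : ℕ} (A : Finset (Fin n)) :
    cordDisc (pathG n) A = |∑ x ∈ range (n - 1), edgeSign (posLabel ∅ A) x| := by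
  have h : ∀ x, edgeSign (posLabel ∅ A) x =
      2 * (if posLabel ∅ A x ≠ posLabel ∅ A (x + 1) then 1 else 0) - 1 := by
    intro x
    rw [edgeSign]
    split_ifs <;> simp_all
  simp only [h, sum_sub_distrib, ← mul_sum, sum_boole, sum_const, card_range]
  rw [cordDisc, edgeCount_pathG, cutSize_pathG]
  simp

theorem abs_edgeSign (s : ℕ → Option Bool) (x : ℕ) : |edgeSign s x| = 1 := by
  rw [edgeSign]
  split_ifs <;> simp

/-- The number of vertices in the `j`-th block of a path on `6 * k + r` vertices. -/
def blockSize (k r j : ℕ) : ℕ := if j < k then 6 else r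

theorem blockSize_le {k r : ℕ} (h₆ : r ≤ 6) (j : ℕ) : blockSize k r j ≤ 6 := by
  rw [blockSize]
  split_ifs <;> omega

theorem six_mul_add_lt {k r j i : ℕ} (h₆ : r ≤ 6) (hj : j ≤ k) (hi : i < blockSize k r j) :
    6 * j + i < 6 * k + r := by
  rw [blockSize] at hi
  split_ifs at hi <;> omega

theorem mod_six_lt_blockSize {k r x : ℕ} (hx : x < 6 * k + r) (hk : x / 6 ≤ k) :
    x % 6 < blockSize k r (x / 6) := by
  rw [blockSize]
  split_ifs <;> omega

/-- The selections in the block of `m` vertices starting at `6 * j`, renumbered from `0`. -/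
def blockLabel (m : ℕ) (s : ℕ → Option Bool) (j i : ℕ) : Option Bool :=
  if i < m then s (6 * j + i) else none

theorem blockLabel_of_lt {m i : ℕ} (s : ℕ → Option Bool) (j : ℕ) (hi : i < m) :
    blockLabel m s j i = s (6 * j + i) := if_pos hi

theorem blockLabel_update_self {m i : ℕ} (s : ℕ → Option Bool) (j : ℕ) (b : Option Bool)
    (hi : i < m) : blockLabel m (Function.update s (6 * j + i) b) j =
      Function.update (blockLabel m s j) i b := by
  funext i'
  by_cases h : i' = i
  · subst h
    simp [blockLabel, hi]
  · simp [blockLabel, h]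

theorem blockLabel_update_of_ne {m i j j' : ℕ} (s : ℕ → Option Bool) (b : Option Bool)
    (hm : m ≤ 6) (hi : i < 6) (h : j' ≠ j) :
    blockLabel m (Function.update s (6 * j + i) b) j' = blockLabel m s j' := by
  funext i'
  rw [blockLabel, blockLabel]
  split_ifs with hi'
  · rw [Function.update_of_ne]
    omega
  · rfl

theorem abs_sum_edgeSign_le {k r : ℕ} (h₀ : 0 < r) {s : ℕ → Option Bool}
    (h : ∀ j ≤ k, BlockDone (blockSize k r j) (blockLabel (blockSize k r j) s j)) :
    |∑ x ∈ range (6 * k + r - 1), edgeSign s x| ≤ 2 * k + blockTol r := by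
  have shift : ∀ m j, ∑ i ∈ range (m - 1), edgeSign (blockLabel m s j) i =
      ∑ i ∈ range (m - 1), edgeSign s (6 * j + i) := by
    refine fun m j => sum_congr rfl fun i hi => ?_
    have := mem_range.1 hi
    rw [edgeSign, edgeSign, blockLabel_of_lt s j (by omega), blockLabel_of_lt s j (by omega),
      add_assoc]
  have full : ∀ l ≤ k, |∑ x ∈ range (6 * l), edgeSign s x| ≤ 2 * l := by
    intro l
    induction l with
    | zero => simp
    | succ l ih =>
      intro hl
      have hb := (h l (by omega)).2
      rw [blockSize, if_pos (by omega), shift] at hb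
      have he := abs_edgeSign s (6 * l + 5)
      have hi := ih (by omega)
      rw [show 6 * (l + 1) = 6 * l + 5 + 1 by ring, sum_range_succ, sum_range_add]
      simp only [Nat.reduceSub, blockTol] at hb
      push_cast
      have := abs_le.1 he.le
      rw [abs_le] at *
      constructor <;> linarith [hb.1, hb.2, hi.1, hi.2, this.1, this.2]
  have hb := (h k le_rfl).2
  rw [blockSize, if_neg (lt_irrefl k), shift] at hb
  rw [show 6 * k + r - 1 = 6 * k + (r - 1) by omega, sum_range_add]
  exact (abs_add_le _ _).trans (add_le_add (full k le_rfl) hb)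

/-- Every block but the `j₀`-th is good for Admirable even if Impish may still pass in it, and
the `j₀`-th is good for him without passes. -/
def BlocksGood (k r j₀ : ℕ) (s : ℕ → Option Bool) : Prop :=
  ∀ j ≤ k, ∃ t, BlockGood (blockSize k r j) t (decide (j ≠ j₀)) (blockLabel (blockSize k r j) s j)

theorem BlocksGood.done {k r j₀ : ℕ} {s : ℕ → Option Bool} (h₆ : r ≤ 6)
    (h : BlocksGood k r j₀ s) (hs : ∀ x < 6 * k + r, s x ≠ none) :
    ∀ j ≤ k, BlockDone (blockSize k r j) (blockLabel (blockSize k r j) s j) := by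
  intro j hj
  obtain ⟨t, ht⟩ := h j hj
  refine ht.done_of_full fun i hi => ?_
  rw [blockLabel_of_lt s j hi]
  exact hs _ (six_mul_add_lt h₆ hj hi)

/-- Only the block `j` containing the changed vertex has to be checked again. -/
theorem BlocksGood.update {k r j₀ j i : ℕ} {s : ℕ → Option Bool} {b : Option Bool} (h₆ : r ≤ 6)
    (h : ∀ j' ≤ k, j' ≠ j → ∃ t, BlockGood (blockSize k r j') t (decide (j' ≠ j₀))
      (blockLabel (blockSize k r j') s j'))
    (hi : i < blockSize k r j)
    (hj : ∃ t, BlockGood (blockSize k r j) t (decide (j ≠ j₀))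
      (Function.update (blockLabel (blockSize k r j) s j) i b)) :
    BlocksGood k r j₀ (Function.update s (6 * j + i) b) := by
  intro j' hj'
  by_cases hne : j' = j
  · subst hne
    rwa [blockLabel_update_self s j' b hi]
  · rw [blockLabel_update_of_ne s b (blockSize_le h₆ j') (hi.trans_le (blockSize_le h₆ j)) hne]
    exact h j' hj' hne

/-- Admirable can answer every Impish move, unless that move completes the labelling. -/
theorem BlocksGood.exists_reply {k r j₀ x : ℕ} {s : ℕ → Option Bool} (h₀ : 0 < r) (h₆ : r ≤ 6)
    (h : BlocksGood k r j₀ s) (hx : x < 6 * k + r) (hn : s x = none) :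
    ((∀ y < 6 * k + r, Function.update s x (some false) y ≠ none) ∧
      ∃ j₁, BlocksGood k r j₁ (Function.update s x (some false))) ∨
    ∃ y < 6 * k + r, Function.update s x (some false) y = none ∧
      ∃ j₁, BlocksGood k r j₁ (Function.update (Function.update s x (some false)) y (some true)) := by
  obtain ⟨j, i, rfl, hj, hi⟩ : ∃ j i, 6 * j + i = x ∧ j ≤ k ∧ i < blockSize k r j :=
    ⟨x / 6, x % 6, by omega, by omega, mod_six_lt_blockSize hx (by omega)⟩
  obtain ⟨t, ht⟩ := h j hj
  have hi₆ := hi.trans_le (blockSize_le h₆ j)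
  have self := blockLabel_update_self s j (some false) hi
  have other : ∀ j' ≤ k, j' ≠ j → ∃ t, BlockGood (blockSize k r j') t (decide (j' ≠ j₀))
      (blockLabel (blockSize k r j') (Function.update s (6 * j + i) (some false)) j') := by
    intro j' hj' hne
    rw [blockLabel_update_of_ne s _ (blockSize_le h₆ j') hi₆ hne]
    exact h j' hj'
  rcases ht.reply hi ((blockLabel_of_lt s j hi).trans hn) with ⟨hb, hd⟩ | ⟨w, hw, hwn, t', ht'⟩
  · obtain rfl : j = j₀ := by simpa using hb
    rw [← self] at hd
    by_cases hfull : ∀ y < 6 * k + r, Function.update s (6 * j + i) (some false) y ≠ none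
    · refine Or.inl ⟨hfull, j, fun j' hj' => ?_⟩
      by_cases hne : j' = j
      · subst hne
        exact ⟨0, hd⟩
      · exact other j' hj' hne
    · push Not at hfull
      obtain ⟨y, hy, hyn⟩ := hfull
      obtain ⟨j₁, i₁, rfl, hj₁, hi₁⟩ : ∃ j i, 6 * j + i = y ∧ j ≤ k ∧ i < blockSize k r j :=
        ⟨y / 6, y % 6, by omega, by omega, mod_six_lt_blockSize hy (by omega)⟩
      rw [← blockLabel_of_lt (Function.update s (6 * j + i) (some false)) j₁ hi₁] at hyn
      have hne : j₁ ≠ j := by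
        rintro rfl
        exact hd.1 i₁ hi₁ hyn
      obtain ⟨t₁, ht₁⟩ := other j₁ hj₁ hne
      rw [decide_eq_true hne] at ht₁
      obtain ⟨w, hw, hwn, t₂, ht₂⟩ := ht₁.pass hi₁ hyn
      rw [blockLabel_of_lt _ j₁ hw] at hwn
      refine Or.inr ⟨6 * j₁ + w, six_mul_add_lt h₆ hj₁ hw, hwn, j₁, .update h₆ ?_ hw ⟨t₂, ?_⟩⟩
      · intro j' hj' hne'
        by_cases hj'j : j' = j
        · subst hj'j
          exact ⟨0, hd⟩
        · obtain ⟨t, ht⟩ := other j' hj' hj'j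
          rw [decide_eq_true hj'j] at ht
          exact ⟨t, by rwa [decide_eq_true hne']⟩
      · simpa using ht₂
  · rw [← self] at hwn ht'
    rw [blockLabel_of_lt _ j hw] at hwn
    exact Or.inr ⟨6 * j + w, six_mul_add_lt h₆ hj hw, hwn, j₀, .update h₆ other hw ⟨t', ht'⟩⟩

theorem cg_pathG_le {k r : ℕ} (h₀ : 0 < r) (h₆ : r ≤ 6) :
    cg (pathG (6 * k + r)) ≤ 2 * k + blockTol r := by
  have full : ∀ {A : Finset (Fin (6 * k + r))}, ∀ x < 6 * k + r, posLabel ∅ A x ≠ none := by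
    intro A x _
    rw [Ne, posLabel_eq_none]
    simp
  have fin : ∀ {A : Finset (Fin (6 * k + r))} {j₀}, BlocksGood k r j₀ (posLabel ∅ A) →
      cordDisc (pathG (6 * k + r)) A ≤ 2 * k + blockTol r := by
    intro A j₀ h
    rw [cordDisc_pathG]
    exact abs_sum_edgeSign_le h₀ (h.done h₆ full)
  obtain ⟨w, hw, hgood⟩ := exists_blockGood_first_move h₀ h₆
  refine cg_le_of_invariant _ _
    (fun R A => Disjoint R A ∧ ∃ j₀, BlocksGood k r j₀ (posLabel R A)) ?_ ?_
    ⟨6 * k + w, by omega⟩ ⟨by simp, k, ?_⟩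
  · rintro A ⟨-, j₀, h⟩
    exact fin h
  · rintro R A v ⟨hd, j₀, h⟩ hv
    have hvA := disjoint_left.1 hd hv
    rcases h.exists_reply h₀ h₆ v.2 (posLabel_eq_none.2 ⟨v.2, hv⟩) with
      ⟨hf, j₁, h₁⟩ | ⟨y, hy, hyn, j₁, h₁⟩ <;> rw [← posLabel_erase hvA] at *
    · left
      have he : R.erase v = ∅ := by
        refine eq_empty_of_forall_notMem fun u hu => hf u u.2 (posLabel_eq_none.2 ⟨u.2, hu⟩)
      rw [he] at h₁
      exact ⟨he, fin h₁⟩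
    · right
      obtain ⟨_, hyR⟩ := posLabel_eq_none.1 hyn
      refine ⟨⟨y, hy⟩, hyR, ?_, j₁, ?_⟩
      · rw [disjoint_insert_right]
        refine ⟨notMem_erase _ _, ?_⟩
        exact hd.mono_left ((erase_subset _ _).trans (erase_subset _ _))
      · rwa [posLabel_erase_insert]
  · have hnone : ∀ j ≤ k, blockLabel (blockSize k r j)
        (posLabel (univ : Finset (Fin (6 * k + r))) ∅) j = fun _ => none := by
      intro j hj
      funext i
      rw [blockLabel]
      split_ifs with hi
      · exact posLabel_eq_none.2 ⟨six_mul_add_lt h₆ hj hi, mem_univ _⟩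
      · rfl
    have hsize : blockSize k r k = r := if_neg (lt_irrefl k)
    rw [← insert_empty_eq, posLabel_erase_insert]
    refine .update h₆ (fun j hj hne => ⟨4, ?_⟩) (hsize.symm ▸ hw) ⟨3, ?_⟩
    · rw [hnone j hj, blockSize, if_pos (by omega), decide_eq_true hne]
      exact blockGood_six
    · rw [hnone k le_rfl, hsize]
      simpa using hgood

/-- for `n ≥ 3`, `c_g(P_n) ≤ 2⌊n/6⌋ - 1` if `n ≡ 0 (mod 6)`,
`c_g(P_n) ≤ 2⌊n/6⌋` if `n ≡ 1, 3 (mod 6)`, `c_g(P_n) ≤ 2⌊n/6⌋ + 1` if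
`n ≡ 2, 4 (mod 6)`, and `c_g(P_n) ≤ 2⌊n/6⌋ + 2` if `n ≡ 5 (mod 6)`. -/
theorem cg_path_upper_bound_six (n : ℕ) (hn : 3 ≤ n) :
    (n % 6 = 0 → cg (pathG n) ≤ 2 * ((n / 6 : ℕ) : ℤ) - 1) ∧
    (n % 6 = 1 ∨ n % 6 = 3 → cg (pathG n) ≤ 2 * ((n / 6 : ℕ) : ℤ)) ∧
    (n % 6 = 2 ∨ n % 6 = 4 → cg (pathG n) ≤ 2 * ((n / 6 : ℕ) : ℤ) + 1) ∧
    (n % 6 = 5 → cg (pathG n) ≤ 2 * ((n / 6 : ℕ) : ℤ) + 2) := by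
  obtain ⟨k, r, h₀, h₆, rfl⟩ : ∃ k r, 0 < r ∧ r ≤ 6 ∧ n = 6 * k + r :=
    ⟨(n - 1) / 6, (n - 1) % 6 + 1, by omega, by omega, by omega⟩
  have h := cg_pathG_le (k := k) h₀ h₆
  refine ⟨fun hr => h.trans ?_, fun hr => h.trans ?_, fun hr => h.trans ?_, fun hr => h.trans ?_⟩
  all_goals interval_cases r <;> simp only [blockTol] <;> omega
end

section
/- Let B be the path v_3v_2v_1 v v_4v_5v_6 on seven vertices, i.e., the tree with edges vv_1, v_1v_2, v_2v_3, vv_4, v_4v_5, v_5v_6. Consider the cordiality game played only on the six vertices {v_1,…,v_6} (the vertex v is not playable and receives an arbitrary label in {0,1}). In each of the three variants (Admirable moves first; Impish moves first; Impish moves first and may pass once), Admirable has a strategy guaranteeing that, for either label of v, the discrepancy |e_1 − e_0| computed over the six edges of B is at most 2. -/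
open Finset

variable {V : Type} [Fintype V] [DecidableEq V]

/-- The path `B = v₃v₂v₁vv₄v₅v₆` on seven vertices
(`v` encoded as `0` and `vᵢ` as `i`), with edges
`vv₁, v₁v₂, v₂v₃, vv₄, v₄v₅, v₅v₆`. -/
def pathB : SimpleGraph (Fin 7) :=
  SimpleGraph.fromRel (fun a b =>
    (a = 0 ∧ b = 1) ∨ (a = 1 ∧ b = 2) ∨ (a = 2 ∧ b = 3) ∨
    (a = 0 ∧ b = 4) ∨ (a = 4 ∧ b = 5) ∨ (a = 5 ∧ b = 6))

instance : DecidableRel pathB.Adj :=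
  fun a b => decidable_of_iff _ (SimpleGraph.fromRel_adj _ a b).symm

/-- The payoff of the restricted game on `B`: the worst discrepancy over the
two possible labels of the non-playable vertex `v = 0` (label `0` puts `v`
with Admirable's set `A`, label `1` leaves it out). -/
def payoffPathB (A : Finset (Fin 7)) : ℤ :=
  max (cordDisc pathB (insert 0 A)) (cordDisc pathB A)

theorem gameVal_of_rem_empty (payoff : Finset V → ℤ) (p : ℕ) (A : Finset V) (turn : Bool) :
    gameVal payoff p ∅ A turn = payoff A := by
  rw [gameVal, dif_neg (by simp)]

theorem gameVal_true_le {payoff : Finset V → ℤ} {p : ℕ} {rem A : Finset V} {k : ℤ} {v : V}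
    (hv : v ∈ rem) (h : gameVal payoff p (rem.erase v) (insert v A) false ≤ k) :
    gameVal payoff p rem A true ≤ k := by
  rw [gameVal, dif_pos ⟨v, hv⟩, if_pos rfl]
  exact (Finset.inf'_le _ (mem_attach rem ⟨v, hv⟩)).trans h

theorem gameVal_false_le {payoff : Finset V → ℤ} {p : ℕ} {rem A : Finset V} {k : ℤ}
    (hrem : rem.Nonempty) (hmove : ∀ v ∈ rem, gameVal payoff p (rem.erase v) A true ≤ k)
    (hpass : p ≠ 0 → gameVal payoff (p - 1) rem A true ≤ k) :
    gameVal payoff p rem A false ≤ k := by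
  have hsup := Finset.sup'_le (attach_nonempty_iff.mpr hrem)
    (fun v : rem => gameVal payoff p (rem.erase v.1) A true) fun v _ => hmove v.1 v.2
  rw [gameVal, dif_pos hrem, if_neg Bool.false_ne_true]
  dsimp only
  split_ifs with hp
  · exact hsup
  · exact max_le hsup (hpass hp)

/-- A position in which Admirable has followed the pairing `σ` of the playable set `U`: he never
holds both vertices of a pair, and any pair in which he holds no vertex is still untouched. -/
structure FollowsPairing (σ : V → V) (U rem A : Finset V) : Prop where
  rem_subset : rem ⊆ U
  notMem_of_mem_rem : ∀ v ∈ rem, v ∉ A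
  partner_notMem : ∀ v ∈ A, σ v ∉ A
  mem_rem : ∀ v ∈ U, v ∉ A → σ v ∉ A → v ∈ rem

section Pairing

variable {σ : V → V} {U rem A : Finset V} {v : V}

theorem FollowsPairing.start (σ : V → V) (U : Finset V) : FollowsPairing σ U U ∅ :=
  ⟨Subset.rfl, by simp, by simp, fun _ hv _ _ => hv⟩

theorem FollowsPairing.take (h : FollowsPairing σ U rem A) (hσ : Function.Involutive σ)
    (hne : ∀ v ∈ U, σ v ≠ v) (hv : v ∈ rem) (hσv : σ v ∉ A) :
    FollowsPairing σ U (rem.erase v) (insert v A) := by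
  obtain ⟨h₁, h₂, h₃, h₄⟩ := h
  have hσσ : ∀ x, σ (σ x) = x := hσ
  refine ⟨fun x hx => h₁ (mem_of_mem_erase hx), ?_, ?_, ?_⟩ <;> grind

theorem FollowsPairing.lose (h : FollowsPairing σ U rem A) (hσv : σ v ∈ A) :
    FollowsPairing σ U (rem.erase v) A := by
  obtain ⟨h₁, h₂, h₃, h₄⟩ := h
  refine ⟨fun x hx => h₁ (mem_of_mem_erase hx), ?_, h₃, ?_⟩ <;> grind

/-- The pairing strategy: if the payoff is at most `k` whenever Admirable holds exactly one vertex
of each pair, then he can guarantee `k`, even if he moves first or Impish may pass once. -/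
theorem gameVal_le_of_pairing {payoff : Finset V → ℤ} {k : ℤ} (hσ : Function.Involutive σ)
    (hU : ∀ v ∈ U, σ v ∈ U) (hne : ∀ v ∈ U, σ v ≠ v)
    (hgood : ∀ S, (∀ v ∈ U, v ∈ S ↔ σ v ∉ S) → payoff S ≤ k) (n : ℕ) :
    ∀ rem A, rem.card = n → FollowsPairing σ U rem A →
      ((∀ v ∈ rem, σ v ∉ A) → gameVal payoff 0 rem A true ≤ k) ∧
      ∀ p ≤ 1, (∀ v ∈ rem, ∀ w ∈ rem, σ v ∈ A → σ w ∈ A → v = w) →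
        (p ≠ 0 → ∀ v ∈ rem, σ v ∉ A) → gameVal payoff p rem A false ≤ k := by
  induction n using Nat.strong_induction_on with
  | _ n ih =>
  rintro rem A rfl h
  rcases rem.eq_empty_or_nonempty with rfl | hrem
  · have hA : payoff A ≤ k := hgood A fun v hv =>
      ⟨h.partner_notMem v, fun hσv => by_contra fun hvA => notMem_empty v (h.mem_rem v hv hvA hσv)⟩
    simp only [gameVal_of_rem_empty]
    exact ⟨fun _ => hA, fun _ _ _ _ => hA⟩
  have hfirst (hopen : ∀ v ∈ rem, σ v ∉ A) : gameVal payoff 0 rem A true ≤ k := by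
    obtain ⟨v, hv⟩ := hrem
    refine gameVal_true_le hv ((ih _ (card_erase_lt_of_mem hv) _ _ rfl
      (h.take hσ hne hv (hopen v hv))).2 0 zero_le_one ?_ (by simp))
    have hinj := hσ.injective
    grind
  refine ⟨hfirst, fun p hp hhalf hopen => gameVal_false_le hrem (fun v hv => ?_) fun hp0 => ?_⟩
  · by_cases hσv : σ v ∈ A
    · obtain rfl : p = 0 := by_contra fun hp0 => hopen hp0 v hv hσv
      exact (ih _ (card_erase_lt_of_mem hv) _ _ rfl (h.lose hσv)).1 (by grind)
    · have hσv' : σ v ∈ rem := h.mem_rem _ (hU v (h.rem_subset hv)) hσv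
        (by rw [hσ v]; exact h.notMem_of_mem_rem v hv)
      have hmem : σ v ∈ rem.erase v := mem_erase.mpr ⟨hne v (h.rem_subset hv), hσv'⟩
      have hinj := hσ.injective
      refine gameVal_true_le hmem ((ih _ ((card_erase_lt_of_mem hmem).trans
        (card_erase_lt_of_mem hv)) _ _ rfl ?_).2 p hp ?_ ?_)
      · obtain ⟨h₁, h₂, h₃, h₄⟩ := h
        have hσσ := hσ v
        refine ⟨?_, ?_, ?_, ?_⟩ <;> grind
      · grind
      · grind
  · obtain rfl : p = 1 := by omega
    exact hfirst (hopen one_ne_zero)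

end Pairing

/-- The pairing `v₁v₃`, `v₂v₅`, `v₄v₆` of the playable vertices of `pathB`. -/
def pairingB : Fin 7 → Fin 7 := ![0, 3, 5, 1, 6, 2, 4]

theorem payoffPathB_le_two_of_pairing : ∀ S : Finset (Fin 7),
    (∀ v ∈ univ.erase (0 : Fin 7), v ∈ S ↔ pairingB v ∉ S) → payoffPathB S ≤ 2 := by
  decide +kernel

/-- in the cordiality game played on the playable vertices
`v₁, …, v₆` of `B`, in all three variants, Admirable can guarantee that for
either label of `v` the discrepancy over the edges of `B` is at most 2. -/
theorem pathB_discrepancy_two :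
    gameVal payoffPathB 0 (univ.erase (0 : Fin 7)) ∅ true ≤ 2 ∧
    gameVal payoffPathB 0 (univ.erase (0 : Fin 7)) ∅ false ≤ 2 ∧
    gameVal payoffPathB 1 (univ.erase (0 : Fin 7)) ∅ false ≤ 2 := by
  have h := gameVal_le_of_pairing (σ := pairingB) (by unfold Function.Involutive; decide)
    (by decide) (by decide) payoffPathB_le_two_of_pairing _ _ _ rfl
    (FollowsPairing.start pairingB (univ.erase 0))
  exact ⟨h.1 (by simp), h.2 0 zero_le_one (by simp) (by simp), h.2 1 le_rfl (by simp) (by simp)⟩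
end
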